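/- Let 𝒜 be a convex cone contained in (0,+∞)ᵖ, and define the norm ‖β‖_𝒜 = inf_{a∈𝒜} (1/2)∑_{j=1}^p ( β_j²/a_j + a_j ) for β ∈ ℝᵖ. If S ⊆ {1,…,p} is admissible with respect to 𝒜, then ‖β‖_𝒜 = ‖β_S‖_𝒜 + ‖β_{S^c}‖_𝒜 for every β ∈ ℝᵖ. -/

import Mathlib

open MeasureTheory

/-- Restriction of a vector to a set of coordinates (zero off `S`). -/
def restr {p : ℕ} (S : Finset (Fin p)) (β : Fin p → ℝ) : Fin p → ℝ :=
  fun j => if j ∈ S then β j else 0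

/-- The norm generated by a convex cone `𝒜 ⊂ (0,∞)ᵖ`:
`‖β‖_𝒜 = inf_{a ∈ 𝒜} (1/2) ∑_j (β_j²/a_j + a_j)`. -/
noncomputable def coneNorm {p : ℕ} (A : Set (Fin p → ℝ)) (β : Fin p → ℝ) : ℝ :=
  sInf {r | ∃ a ∈ A, r = (1 / 2) * ∑ j, (β j ^ 2 / a j + a j)}

/-- `S` is admissible with respect to `𝒜`: for every `a ∈ 𝒜` and `ε > 0` there are
vectors `b_{Sᶜ}`, `b_S` supported on `Sᶜ` and `S` with supported components in `(0,ε)`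
such that `a_S + b_{Sᶜ} ∈ 𝒜` and `a_{Sᶜ} + b_S ∈ 𝒜`. -/
def Admissible {p : ℕ} (A : Set (Fin p → ℝ)) (S : Finset (Fin p)) : Prop :=
  ∀ a ∈ A, ∀ ε > (0:ℝ), ∃ bc bs : Fin p → ℝ,
    (∀ j ∈ S, bc j = 0) ∧ (∀ j ∉ S, 0 < bc j ∧ bc j < ε) ∧
    (∀ j ∉ S, bs j = 0) ∧ (∀ j ∈ S, 0 < bs j ∧ bs j < ε) ∧
    (restr S a + bc) ∈ A ∧ (restr Sᶜ a + bs) ∈ A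

lemma coneNorm_le {p : ℕ} {A : Set (Fin p → ℝ)} (hApos : ∀ a ∈ A, ∀ j, 0 < a j)
    (β : Fin p → ℝ) {a : Fin p → ℝ} (ha : a ∈ A) :
    coneNorm A β ≤ (1 / 2) * ∑ j, (β j ^ 2 / a j + a j) := by
  refine csInf_le ⟨0, ?_⟩ ⟨a, ha, rfl⟩
  rintro r ⟨b, hb, rfl⟩
  have : 0 ≤ ∑ j, (β j ^ 2 / b j + b j) := Finset.sum_nonneg fun j _ => by
    have := hApos b hb j
    positivity
  positivity

lemma exists_lt_coneNorm_add {p : ℕ} {A : Set (Fin p → ℝ)} (hAne : A.Nonempty)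
    (β : Fin p → ℝ) {ε : ℝ} (hε : 0 < ε) :
    ∃ a ∈ A, (1 / 2) * ∑ j, (β j ^ 2 / a j + a j) < coneNorm A β + ε := by
  obtain ⟨a₀, ha₀⟩ := hAne
  obtain ⟨r, ⟨a, ha, rfl⟩, hr⟩ :=
    exists_lt_of_csInf_lt (s := {r | ∃ a ∈ A, r = (1 / 2) * ∑ j, (β j ^ 2 / a j + a j)})
      ⟨_, a₀, ha₀, rfl⟩ (lt_add_of_pos_right (coneNorm A β) hε)
  exact ⟨a, ha, hr⟩

lemma add_mem_of_convex_cone {E : Type*} [AddCommGroup E] [Module ℝ E] {A : Set E}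
    (hAconv : Convex ℝ A) (hAcone : ∀ c : ℝ, 0 < c → ∀ a ∈ A, c • a ∈ A)
    {a b : E} (ha : a ∈ A) (hb : b ∈ A) : a + b ∈ A := by
  have h := hAcone 2 two_pos _
    (hAconv ha hb (by norm_num : (0 : ℝ) ≤ 1 / 2) (by norm_num : (0 : ℝ) ≤ 1 / 2) (by norm_num))
  simpa [smul_add, smul_smul] using h

theorem stmt13 (p : ℕ)
    (A : Set (Fin p → ℝ)) (hAne : A.Nonempty)
    (hApos : ∀ a ∈ A, ∀ j, 0 < a j)
    (hAconv : Convex ℝ A)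
    (hAcone : ∀ (c : ℝ), 0 < c → ∀ a ∈ A, c • a ∈ A)
    (S : Finset (Fin p)) (hS : Admissible A S) :
    ∀ β : Fin p → ℝ,
      coneNorm A β = coneNorm A (restr S β) + coneNorm A (restr Sᶜ β) := by
  intro β
  apply le_antisymm
  · refine le_of_forall_pos_le_add fun ε hε => ?_
    set δ := ε / (p + 2) with hδ
    have hδ0 : 0 < δ := by positivity
    obtain ⟨a, ha, ha'⟩ := exists_lt_coneNorm_add hAne (restr S β) hδ0
    obtain ⟨b, hb, hb'⟩ := exists_lt_coneNorm_add hAne (restr Sᶜ β) hδ0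
    obtain ⟨ac, -, hac0, hac, -, -, haA, -⟩ := hS a ha δ hδ0
    obtain ⟨-, bs, -, -, hbs0, hbs, -, hbA⟩ := hS b hb δ hδ0
    have key := coneNorm_le hApos β (add_mem_of_convex_cone hAconv hAcone haA hbA)
    have hsum : ∑ j, (β j ^ 2 / (restr S a + ac + (restr Sᶜ b + bs)) j
          + (restr S a + ac + (restr Sᶜ b + bs)) j)
        ≤ ∑ j, (((restr S β j ^ 2 / a j + a j) + (restr Sᶜ β j ^ 2 / b j + b j)) + δ) := by
      refine Finset.sum_le_sum fun j _ => ?_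
      have haj := hApos a ha j
      have hbj := hApos b hb j
      by_cases hj : j ∈ S
      · obtain ⟨h1, h2⟩ := hbs j hj
        have : β j ^ 2 / (a j + bs j) ≤ β j ^ 2 / a j := by gcongr; linarith
        simp [restr, hj, hac0 j hj]
        linarith
      · obtain ⟨h1, h2⟩ := hac j hj
        have : β j ^ 2 / (ac j + b j) ≤ β j ^ 2 / b j := by gcongr; linarith
        simp [restr, hj, hbs0 j hj]
        linarith
    simp only [Finset.sum_add_distrib, Finset.sum_const, Finset.card_univ, Fintype.card_fin,
      nsmul_eq_mul] at hsum key ha' hb'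
    have hε' : p * δ + 2 * δ = ε := by rw [hδ]; field_simp
    have : 0 ≤ p * δ := by positivity
    linarith
  · refine le_of_forall_pos_le_add fun ε hε => ?_
    set δ := ε / (p + 1) with hδ
    have hδ0 : 0 < δ := by positivity
    obtain ⟨a, ha, ha'⟩ := exists_lt_coneNorm_add hAne β hδ0
    obtain ⟨ac, as, hac0, hac, has0, has, haA, haA'⟩ := hS a ha δ hδ0
    have key := coneNorm_le hApos (restr S β) haA
    have key' := coneNorm_le hApos (restr Sᶜ β) haA'
    have hsum : ∑ j, ((restr S β j ^ 2 / (restr S a + ac) j + (restr S a + ac) j)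
          + (restr Sᶜ β j ^ 2 / (restr Sᶜ a + as) j + (restr Sᶜ a + as) j))
        ≤ ∑ j, ((β j ^ 2 / a j + a j) + δ) := by
      refine Finset.sum_le_sum fun j _ => ?_
      by_cases hj : j ∈ S
      · have := has j hj
        simp [restr, hj, hac0 j hj]
        linarith
      · have := hac j hj
        simp [restr, hj, has0 j hj]
        linarith
    simp only [Finset.sum_add_distrib, Finset.sum_const, Finset.card_univ, Fintype.card_fin,
      nsmul_eq_mul] at hsum key key' ha'
    have hε' : p * δ + δ = ε := by rw [hδ]; field_simp
    have : 0 ≤ p * δ := by positivity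
    linarith
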